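/- arXiv:2512.11540 — 3 statements merged into one kernel-verified Lean document; each statement's English description precedes it below -/
import Mathlib

section
/- Let k be a field of characteristic zero, A a k-vector space with two bilinear products ∗ and ∘, and let (B, ⋄) be the perm algebra of the specific example (free k-module on (ℤ×ℤ)×{1,2} with the vector-field-type product). Then (A ⊗ B, ·, [−,−]), with the induced product and induced bracket, is a Poisson algebra if and only if (A, ∗, ∘) is a pre-Poisson algebra. -/
open TensorProduct

noncomputable section

def IsZinbiel {k A : Type} [Field k] [AddCommGroup A] [Module k A]
    (ast : A →ₗ[k] A →ₗ[k] A) : Prop :=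
  ∀ a₁ a₂ a₃ : A, ast a₁ (ast a₂ a₃) = ast (ast a₁ a₂) a₃ + ast (ast a₂ a₁) a₃

def IsPreLie {k A : Type} [Field k] [AddCommGroup A] [Module k A]
    (circ : A →ₗ[k] A →ₗ[k] A) : Prop :=
  ∀ a₁ a₂ a₃ : A,
    circ (circ a₁ a₂) a₃ - circ a₁ (circ a₂ a₃)
      = circ (circ a₂ a₁) a₃ - circ a₂ (circ a₁ a₃)

def IsPerm {k B : Type} [Field k] [AddCommGroup B] [Module k B]
    (dia : B →ₗ[k] B →ₗ[k] B) : Prop :=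
  ∀ b₁ b₂ b₃ : B,
    dia b₁ (dia b₂ b₃) = dia (dia b₁ b₂) b₃ ∧
    dia (dia b₁ b₂) b₃ = dia (dia b₂ b₁) b₃

def IsPrePoisson {k A : Type} [Field k] [AddCommGroup A] [Module k A]
    (ast circ : A →ₗ[k] A →ₗ[k] A) : Prop :=
  IsZinbiel ast ∧ IsPreLie circ ∧
  (∀ a₁ a₂ a₃ : A,
    ast (circ a₁ a₂ - circ a₂ a₁) a₃ = circ a₁ (ast a₂ a₃) - ast a₂ (circ a₁ a₃)) ∧
  (∀ a₁ a₂ a₃ : A,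
    circ (ast a₁ a₂ + ast a₂ a₁) a₃ = ast a₁ (circ a₂ a₃) + ast a₂ (circ a₁ a₃))

def IsPoisson {k P : Type} [Field k] [AddCommGroup P] [Module k P]
    (mul br : P →ₗ[k] P →ₗ[k] P) : Prop :=
  (∀ u v : P, mul u v = mul v u) ∧
  (∀ u v w : P, mul (mul u v) w = mul u (mul v w)) ∧
  (∀ u v : P, br u v = - br v u) ∧
  (∀ u v w : P, br (br u v) w + br (br v w) u + br (br w u) v = 0) ∧
  (∀ u v w : P, br u (mul v w) = mul (br u v) w + mul v (br u w))

def idm (k M : Type) [Field k] [AddCommGroup M] [Module k M] : M →ₗ[k] M :=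
  LinearMap.id

def tau (k M : Type) [Field k] [AddCommGroup M] [Module k M] :
    M ⊗[k] M →ₗ[k] M ⊗[k] M :=
  (TensorProduct.comm k M M).toLinearMap

def unassoc (k M : Type) [Field k] [AddCommGroup M] [Module k M] :
    M ⊗[k] (M ⊗[k] M) →ₗ[k] (M ⊗[k] M) ⊗[k] M :=
  (TensorProduct.assoc k M M M).symm.toLinearMap

def intch (k A B : Type) [Field k] [AddCommGroup A] [Module k A]
    [AddCommGroup B] [Module k B] :
    (A ⊗[k] A) ⊗[k] (B ⊗[k] B) →ₗ[k] (A ⊗[k] B) ⊗[k] (A ⊗[k] B) :=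
  (TensorProduct.tensorTensorTensorComm k A A B B).toLinearMap

def IsZinbielCo {k A : Type} [Field k] [AddCommGroup A] [Module k A]
    (ϑ : A →ₗ[k] A ⊗[k] A) : Prop :=
  ∀ a : A,
    TensorProduct.map ϑ (idm k A) (ϑ a)
      + TensorProduct.map (tau k A) (idm k A) (TensorProduct.map ϑ (idm k A) (ϑ a))
    = unassoc k A (TensorProduct.map (idm k A) ϑ (ϑ a))

def IsPermCo {k B : Type} [Field k] [AddCommGroup B] [Module k B]
    (ν : B →ₗ[k] B ⊗[k] B) : Prop :=
  ∀ b : B,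
    TensorProduct.map ν (idm k B) (ν b)
      = unassoc k B (TensorProduct.map (idm k B) ν (ν b)) ∧
    TensorProduct.map ν (idm k B) (ν b)
      = TensorProduct.map (tau k B) (idm k B) (TensorProduct.map ν (idm k B) (ν b))

def IsPreLieCo {k A : Type} [Field k] [AddCommGroup A] [Module k A]
    (θ : A →ₗ[k] A ⊗[k] A) : Prop :=
  ∀ a : A,
    unassoc k A (TensorProduct.map (idm k A) θ (θ a))
      - TensorProduct.map (tau k A) (idm k A)
          (unassoc k A (TensorProduct.map (idm k A) θ (θ a)))
    = TensorProduct.map θ (idm k A) (θ a)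
      - TensorProduct.map (tau k A) (idm k A) (TensorProduct.map θ (idm k A) (θ a))

def Zexp {k A : Type} [Field k] [AddCommGroup A] [Module k A]
    (ast : A →ₗ[k] A →ₗ[k] A) {p : ℕ} (x y : Fin p → A) : (A ⊗[k] A) ⊗[k] A :=
  ∑ i : Fin p, ∑ j : Fin p,
    (((ast (x i) (x j)) ⊗ₜ[k] (y j)) ⊗ₜ[k] (y i)
      + ((y j) ⊗ₜ[k] (ast (x i) (x j))) ⊗ₜ[k] (y i)
      + ((x i) ⊗ₜ[k] (x j)) ⊗ₜ[k] (ast (y i) (y j))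
      + ((x j) ⊗ₜ[k] (x i)) ⊗ₜ[k] (ast (y i) (y j))
      - ((x i) ⊗ₜ[k] (ast (y i) (x j))) ⊗ₜ[k] (y j)
      - ((x j) ⊗ₜ[k] (ast (x i) (y j))) ⊗ₜ[k] (y i)
      - ((ast (x i) (y j)) ⊗ₜ[k] (x j)) ⊗ₜ[k] (y i)
      - ((ast (y i) (x j)) ⊗ₜ[k] (x i)) ⊗ₜ[k] (y j))

def PLexp {k A : Type} [Field k] [AddCommGroup A] [Module k A]
    (circ : A →ₗ[k] A →ₗ[k] A) {p : ℕ} (x y : Fin p → A) : (A ⊗[k] A) ⊗[k] A :=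
  ∑ i : Fin p, ∑ j : Fin p,
    (((circ (x i) (x j)) ⊗ₜ[k] (y j)) ⊗ₜ[k] (y i)
      + ((x j) ⊗ₜ[k] (circ (x i) (y j))) ⊗ₜ[k] (y i)
      + ((circ (y i) (x j)) ⊗ₜ[k] (x i)) ⊗ₜ[k] (y j)
      + ((x j) ⊗ₜ[k] (x i)) ⊗ₜ[k] (circ (y i) (y j))
      - ((y j) ⊗ₜ[k] (circ (x i) (x j))) ⊗ₜ[k] (y i)
      - ((x i) ⊗ₜ[k] (circ (y i) (x j))) ⊗ₜ[k] (y j)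
      - ((circ (x i) (y j)) ⊗ₜ[k] (x j)) ⊗ₜ[k] (y i)
      - ((x i) ⊗ₜ[k] (x j)) ⊗ₜ[k] (circ (y i) (y j)))

def AYexp {k P : Type} [Field k] [AddCommGroup P] [Module k P]
    (m : P →ₗ[k] P →ₗ[k] P) {ι : Type} [Fintype ι] (u v : ι → P) :
    (P ⊗[k] P) ⊗[k] P :=
  ∑ α : ι, ∑ β : ι,
    (((m (u α) (u β)) ⊗ₜ[k] (v α)) ⊗ₜ[k] (v β)
      + ((u α) ⊗ₜ[k] (m (v α) (u β))) ⊗ₜ[k] (v β)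
      - ((u β) ⊗ₜ[k] (u α)) ⊗ₜ[k] (m (v α) (v β)))

def CYexp {k P : Type} [Field k] [AddCommGroup P] [Module k P]
    (br : P →ₗ[k] P →ₗ[k] P) {ι : Type} [Fintype ι] (u v : ι → P) :
    (P ⊗[k] P) ⊗[k] P :=
  ∑ α : ι, ∑ β : ι,
    (((br (u α) (u β)) ⊗ₜ[k] (v α)) ⊗ₜ[k] (v β)
      + ((u α) ⊗ₜ[k] (u β)) ⊗ₜ[k] (br (v α) (v β))
      + ((u α) ⊗ₜ[k] (br (v α) (u β))) ⊗ₜ[k] (v β))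

def sharp (k : Type) [Field k] {V : Type} [AddCommGroup V] [Module k V]
    (s : V ⊗[k] V) (ξ : V →ₗ[k] k) : V :=
  TensorProduct.lid k V (LinearMap.rTensor V ξ s)

abbrev PermB (k : Type) [Field k] : Type := ((ℤ × ℤ) × Fin 2) →₀ k

def bB (k : Type) [Field k] (i₁ i₂ : ℤ) (s : Fin 2) : PermB k :=
  Finsupp.single ((i₁, i₂), s) 1

section Helpers

variable {k A B : Type} [Field k] [AddCommGroup A] [Module k A] [AddCommGroup B] [Module k B]

lemma TensorProduct.induction_on₂ {p : A ⊗[k] B → A ⊗[k] B → Prop}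
    (tmul : ∀ a₁ a₂ b₁ b₂, p (a₁ ⊗ₜ b₁) (a₂ ⊗ₜ b₂))
    (add₁ : ∀ u u' v, p u v → p u' v → p (u + u') v)
    (add₂ : ∀ u v v', p u v → p u v' → p u (v + v')) (u v : A ⊗[k] B) : p u v := by
  induction u using TensorProduct.induction_on with
  | zero =>
    induction v using TensorProduct.induction_on with
    | zero => simpa using tmul 0 0 0 0
    | tmul a b => simpa using tmul 0 a 0 b
    | add v v' h h' => exact add₂ _ _ _ h h'
  | tmul a b =>
    induction v using TensorProduct.induction_on with
    | zero => simpa using tmul a 0 b 0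
    | tmul a' b' => exact tmul _ _ _ _
    | add v v' h h' => exact add₂ _ _ _ h h'
  | add u u' h h' => exact add₁ _ _ _ h h'

lemma TensorProduct.induction_on₃ {p : A ⊗[k] B → A ⊗[k] B → A ⊗[k] B → Prop}
    (tmul : ∀ a₁ a₂ a₃ b₁ b₂ b₃, p (a₁ ⊗ₜ b₁) (a₂ ⊗ₜ b₂) (a₃ ⊗ₜ b₃))
    (add₁ : ∀ u u' v w, p u v w → p u' v w → p (u + u') v w)
    (add₂ : ∀ u v v' w, p u v w → p u v' w → p u (v + v') w)
    (add₃ : ∀ u v w w', p u v w → p u v w' → p u v (w + w')) (u v w : A ⊗[k] B) :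
    p u v w := by
  induction w using TensorProduct.induction_on with
  | zero =>
    refine TensorProduct.induction_on₂ (p := fun u v => p u v 0) (fun a₁ a₂ b₁ b₂ => ?_)
      (fun _ _ _ => add₁ _ _ _ _) (fun _ _ _ => add₂ _ _ _ _) u v
    simpa using tmul a₁ a₂ 0 b₁ b₂ 0
  | tmul a b =>
    exact TensorProduct.induction_on₂ (p := fun u v => p u v (a ⊗ₜ b))
      (fun _ _ _ _ => tmul _ _ _ _ _ _)
      (fun _ _ _ => add₁ _ _ _ _) (fun _ _ _ => add₂ _ _ _ _) u v
  | add w w' h h' => exact add₃ _ _ _ _ h h'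

lemma isPerm_of_bB {dia : PermB k →ₗ[k] PermB k →ₗ[k] PermB k}
    (hdia : ∀ (i₁ i₂ j₁ j₂ : ℤ) (s t : Fin 2),
      dia (bB k i₁ i₂ s) (bB k j₁ j₂ t)
        = if s = 0 then bB k (i₁ + j₁ + 1) (i₂ + j₂) t
          else bB k (i₁ + j₁) (i₂ + j₂ + 1) t) :
    IsPerm dia := by
  have basis : ∀ (i₁ i₂ j₁ j₂ l₁ l₂ : ℤ) (s t r : Fin 2),
      dia (bB k i₁ i₂ s) (dia (bB k j₁ j₂ t) (bB k l₁ l₂ r))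
        = dia (dia (bB k i₁ i₂ s) (bB k j₁ j₂ t)) (bB k l₁ l₂ r) ∧
      dia (dia (bB k i₁ i₂ s) (bB k j₁ j₂ t)) (bB k l₁ l₂ r)
        = dia (dia (bB k j₁ j₂ t) (bB k i₁ i₂ s)) (bB k l₁ l₂ r) := by
    intro i₁ i₂ j₁ j₂ l₁ l₂ s t r
    fin_cases s <;> fin_cases t <;> simp [hdia] <;> constructor <;> congr 1 <;> ring
  have single : ∀ (x : (ℤ × ℤ) × Fin 2) (c : k),
      Finsupp.single x c = c • bB k x.1.1 x.1.2 x.2 := fun x c => by simp [bB]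
  intro b₁ b₂ b₃
  induction b₁ using Finsupp.induction_linear with
  | zero => simp
  | add f g hf hg =>
    simp only [map_add, LinearMap.add_apply]
    exact ⟨congrArg₂ (· + ·) hf.1 hg.1, congrArg₂ (· + ·) hf.2 hg.2⟩
  | single x c =>
    induction b₂ using Finsupp.induction_linear with
    | zero => simp
    | add f g hf hg =>
      simp only [map_add, LinearMap.add_apply]
      exact ⟨congrArg₂ (· + ·) hf.1 hg.1, congrArg₂ (· + ·) hf.2 hg.2⟩
    | single y d =>
      induction b₃ using Finsupp.induction_linear with
      | zero => simp
      | add f g hf hg =>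
        simp only [map_add]
        exact ⟨congrArg₂ (· + ·) hf.1 hg.1, congrArg₂ (· + ·) hf.2 hg.2⟩
      | single z e =>
        have h := basis x.1.1 x.1.2 y.1.1 y.1.2 z.1.1 z.1.2 x.2 y.2 z.2
        simp only [single, map_smul, LinearMap.smul_apply]
        rw [h.1, h.2]
        exact ⟨rfl, by rw [smul_comm c d]⟩

/-- The coefficient in `A` of a basis vector of `PermB k`. -/
def permCoeff (k A : Type) [Field k] [AddCommGroup A] [Module k A] (x : (ℤ × ℤ) × Fin 2) :
    A ⊗[k] PermB k →ₗ[k] A :=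
  (TensorProduct.rid k A).toLinearMap ∘ₗ LinearMap.lTensor A (Finsupp.lapply x)

lemma permCoeff_tmul_bB (x : (ℤ × ℤ) × Fin 2) (a : A) (i₁ i₂ : ℤ) (s : Fin 2) :
    permCoeff k A x (a ⊗ₜ bB k i₁ i₂ s) = if ((i₁, i₂), s) = x then a else 0 := by
  classical
  simp only [permCoeff, bB, LinearMap.comp_apply, LinearMap.lTensor_tmul, Finsupp.lapply_apply,
    Finsupp.single_apply]
  split_ifs <;> simp

lemma isPoisson_of_isPrePoisson {ast circ : A →ₗ[k] A →ₗ[k] A} {dia : B →ₗ[k] B →ₗ[k] B}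
    (hperm : IsPerm dia)
    {m br : A ⊗[k] B →ₗ[k] A ⊗[k] B →ₗ[k] A ⊗[k] B}
    (hm : ∀ (a₁ a₂ : A) (b₁ b₂ : B),
      m (a₁ ⊗ₜ[k] b₁) (a₂ ⊗ₜ[k] b₂)
        = (ast a₁ a₂) ⊗ₜ[k] (dia b₁ b₂) + (ast a₂ a₁) ⊗ₜ[k] (dia b₂ b₁))
    (hbr : ∀ (a₁ a₂ : A) (b₁ b₂ : B),
      br (a₁ ⊗ₜ[k] b₁) (a₂ ⊗ₜ[k] b₂)
        = (circ a₁ a₂) ⊗ₜ[k] (dia b₁ b₂) - (circ a₂ a₁) ⊗ₜ[k] (dia b₂ b₁))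
    (h : IsPrePoisson ast circ) : IsPoisson m br := by
  obtain ⟨hZ, hL, h₁, h₂⟩ := h
  unfold IsZinbiel at hZ
  have assoc : ∀ b₁ b₂ b₃, dia (dia b₁ b₂) b₃ = dia b₁ (dia b₂ b₃) :=
    fun b₁ b₂ b₃ => (hperm b₁ b₂ b₃).1.symm
  have comm : ∀ b₁ b₂ b₃, dia b₁ (dia b₂ b₃) = dia b₂ (dia b₁ b₃) := fun b₁ b₂ b₃ => by
    rw [← assoc, (hperm b₁ b₂ b₃).2, assoc]
  refine ⟨?_, ?_, ?_, ?_, ?_⟩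
  · refine TensorProduct.induction_on₂ ?_ ?_ ?_
    · intro a₁ a₂ b₁ b₂
      rw [hm, hm, add_comm]
    all_goals
      intro _ _ _ hu hv
      simp only [map_add, LinearMap.add_apply]
      linear_combination (norm := abel) hu + hv
  · refine TensorProduct.induction_on₃ ?_ ?_ ?_ ?_
    · intro a₁ a₂ a₃ b₁ b₂ b₃
      simp only [hm, map_add, LinearMap.add_apply, assoc, hZ, add_tmul]
      rw [comm b₃ b₁ b₂, comm b₃ b₂ b₁, comm b₂ b₁ b₃]
      abel
    all_goals
      intro _ _ _ _ hu hv
      simp only [map_add, LinearMap.add_apply]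
      linear_combination (norm := abel) hu + hv
  · refine TensorProduct.induction_on₂ ?_ ?_ ?_
    · intro a₁ a₂ b₁ b₂
      rw [hbr, hbr, neg_sub]
    all_goals
      intro _ _ _ hu hv
      simp only [map_add, LinearMap.add_apply]
      linear_combination (norm := abel) hu + hv
  · refine TensorProduct.induction_on₃ ?_ ?_ ?_ ?_
    · intro a₁ a₂ a₃ b₁ b₂ b₃
      have e₁ := congrArg (· ⊗ₜ[k] dia b₂ (dia b₃ b₁)) (hL a₂ a₃ a₁)
      have e₂ := congrArg (· ⊗ₜ[k] dia b₃ (dia b₁ b₂)) (hL a₃ a₁ a₂)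
      have e₃ := congrArg (· ⊗ₜ[k] dia b₁ (dia b₂ b₃)) (hL a₁ a₂ a₃)
      simp only [sub_tmul] at e₁ e₂ e₃
      simp only [hbr, map_sub, LinearMap.sub_apply, assoc]
      rw [comm b₃ b₂ b₁, comm b₁ b₃ b₂, comm b₂ b₁ b₃]
      linear_combination (norm := abel) e₁ + e₂ + e₃
    all_goals
      intro _ _ _ _ hu hv
      simp only [map_add, LinearMap.add_apply]
      linear_combination (norm := abel) hu + hv
  · refine TensorProduct.induction_on₃ ?_ ?_ ?_ ?_
    · intro a₁ a₂ a₃ b₁ b₂ b₃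
      have e₁ := congrArg (· ⊗ₜ[k] dia b₂ (dia b₃ b₁)) (h₂ a₂ a₃ a₁)
      have e₂ := congrArg (· ⊗ₜ[k] dia b₁ (dia b₃ b₂)) (h₁ a₁ a₃ a₂)
      have e₃ := congrArg (· ⊗ₜ[k] dia b₁ (dia b₂ b₃)) (h₁ a₁ a₂ a₃)
      simp only [map_sub, map_add, LinearMap.sub_apply, LinearMap.add_apply, sub_tmul,
        add_tmul] at e₁ e₂ e₃
      simp only [hbr, hm, map_sub, map_add, LinearMap.sub_apply, assoc]
      rw [comm b₃ b₂ b₁, comm b₃ b₁ b₂, comm b₂ b₁ b₃]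
      linear_combination (norm := abel) -e₁ - e₂ - e₃
    all_goals
      intro _ _ _ _ hu hv
      simp only [map_add, LinearMap.add_apply]
      linear_combination (norm := abel) hu + hv

end Helpers

theorem statement3 (k A : Type) [Field k] [CharZero k]
    [AddCommGroup A] [Module k A]
    (ast circ : A →ₗ[k] A →ₗ[k] A)
    (dia : PermB k →ₗ[k] PermB k →ₗ[k] PermB k)
    (hdia : ∀ (i₁ i₂ j₁ j₂ : ℤ) (s t : Fin 2),
      dia (bB k i₁ i₂ s) (bB k j₁ j₂ t)
        = if s = 0 then bB k (i₁ + j₁ + 1) (i₂ + j₂) t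
          else bB k (i₁ + j₁) (i₂ + j₂ + 1) t)
    (m : A ⊗[k] PermB k →ₗ[k] A ⊗[k] PermB k →ₗ[k] A ⊗[k] PermB k)
    (hm : ∀ (a₁ a₂ : A) (b₁ b₂ : PermB k),
      m (a₁ ⊗ₜ[k] b₁) (a₂ ⊗ₜ[k] b₂)
        = (ast a₁ a₂) ⊗ₜ[k] (dia b₁ b₂) + (ast a₂ a₁) ⊗ₜ[k] (dia b₂ b₁))
    (br : A ⊗[k] PermB k →ₗ[k] A ⊗[k] PermB k →ₗ[k] A ⊗[k] PermB k)
    (hbr : ∀ (a₁ a₂ : A) (b₁ b₂ : PermB k),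
      br (a₁ ⊗ₜ[k] b₁) (a₂ ⊗ₜ[k] b₂)
        = (circ a₁ a₂) ⊗ₜ[k] (dia b₁ b₂) - (circ a₂ a₁) ⊗ₜ[k] (dia b₂ b₁))
    :
    IsPoisson (k := k) (P := A ⊗[k] PermB k) m br ↔ IsPrePoisson ast circ := by
  refine ⟨fun ⟨_, hassoc, _, hjac, hleib⟩ => ⟨fun a₁ a₂ a₃ => ?_, fun a₁ a₂ a₃ => ?_,
    fun a₁ a₂ a₃ => ?_, fun a₁ a₂ a₃ => ?_⟩, isPoisson_of_isPrePoisson (isPerm_of_bB hdia) hm hbr⟩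
  · have h := congrArg (permCoeff k A ((2, 0), 1))
      (hassoc (a₁ ⊗ₜ bB k 0 0 0) (a₂ ⊗ₜ bB k 0 0 0) (a₃ ⊗ₜ bB k 0 0 1))
    simp [hm, hdia, permCoeff_tmul_bB] at h
    exact h.symm
  · have h := congrArg (permCoeff k A ((2, 0), 1))
      (hjac (a₁ ⊗ₜ bB k 0 0 0) (a₂ ⊗ₜ bB k 0 0 0) (a₃ ⊗ₜ bB k 0 0 1))
    simp [hbr, hdia, permCoeff_tmul_bB] at h
    linear_combination (norm := abel) h
  · have h := congrArg (permCoeff k A ((2, 0), 1))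
      (hleib (a₁ ⊗ₜ bB k 0 0 0) (a₂ ⊗ₜ bB k 0 0 0) (a₃ ⊗ₜ bB k 0 0 1))
    simp [hm, hbr, hdia, permCoeff_tmul_bB] at h
    simp only [map_sub, LinearMap.sub_apply]
    linear_combination (norm := abel) -h
  · have h := congrArg (permCoeff k A ((2, 0), 1))
      (hleib (a₃ ⊗ₜ bB k 0 0 1) (a₁ ⊗ₜ bB k 0 0 0) (a₂ ⊗ₜ bB k 0 0 0))
    simp [hm, hbr, hdia, permCoeff_tmul_bB] at h
    simp only [map_add, LinearMap.add_apply]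
    linear_combination (norm := abel) -h
end
end

section
/- Let k be a field of characteristic zero, (A, ∗, ϑ) a finite-dimensional Zinbiel bialgebra and (B, ⋄, ω) a quadratic perm algebra over k. Let · be the induced product on A ⊗ B and define Δ : A ⊗ B → (A ⊗ B) ⊗ (A ⊗ B) by Δ(a ⊗ b) = (id ⊗ id + τ)(ϑ(a) • ν_ω(b)). Then (A ⊗ B, ·, Δ) is an infinitesimal bialgebra. -/
open TensorProduct

noncomputable section

section Tensors

variable {k : Type} [Field k] {M : Type} [AddCommGroup M] [Module k M]
  {A : Type} [AddCommGroup A] [Module k A] {B : Type} [AddCommGroup B] [Module k B]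

@[simp] lemma idm_apply (x : M) : idm k M x = x := rfl

@[simp] lemma tau_tmul (x y : M) : tau k M (x ⊗ₜ[k] y) = y ⊗ₜ[k] x := rfl

@[simp] lemma tau_tau (t : M ⊗[k] M) : tau k M (tau k M t) = t :=
  (TensorProduct.comm k M M).symm_apply_apply t

@[simp] lemma unassoc_tmul (x y z : M) :
    unassoc k M (x ⊗ₜ[k] (y ⊗ₜ[k] z)) = (x ⊗ₜ[k] y) ⊗ₜ[k] z := rfl

@[simp] lemma intch_tmul (a a' : A) (b b' : B) :
    intch k A B ((a ⊗ₜ[k] a') ⊗ₜ[k] (b ⊗ₜ[k] b'))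
      = (a ⊗ₜ[k] b) ⊗ₜ[k] (a' ⊗ₜ[k] b') := rfl

lemma tau_map (f g : M →ₗ[k] M) (t : M ⊗[k] M) :
    tau k M (TensorProduct.map f g t) = TensorProduct.map g f (tau k M t) := by
  induction t with
  | zero => simp
  | tmul x y => simp
  | add x y hx hy => simp only [map_add, hx, hy]

lemma tau_intch (s : A ⊗[k] A) (t : B ⊗[k] B) :
    tau k (A ⊗[k] B) (intch k A B (s ⊗ₜ[k] t))
      = intch k A B (tau k A s ⊗ₜ[k] tau k B t) := by
  induction s with
  | zero => simp
  | add x y hx hy => simp only [map_add, TensorProduct.add_tmul, hx, hy]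
  | tmul a a' =>
    induction t with
    | zero => simp
    | add x y hx hy => simp only [map_add, TensorProduct.tmul_add, hx, hy]
    | tmul b b' => simp

/-- Interchange of a product of pairs of maps. -/
lemma map_map_intch (f f' : A →ₗ[k] A) (g g' : B →ₗ[k] B) (s : A ⊗[k] A) (t : B ⊗[k] B) :
    TensorProduct.map (TensorProduct.map f g) (TensorProduct.map f' g')
        (intch k A B (s ⊗ₜ[k] t))
      = intch k A B (TensorProduct.map f f' s ⊗ₜ[k] TensorProduct.map g g' t) := by
  induction s with
  | zero => simp
  | add x y hx hy => simp only [map_add, TensorProduct.add_tmul, hx, hy]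
  | tmul a a' =>
    induction t with
    | zero => simp
    | add x y hx hy => simp only [map_add, TensorProduct.tmul_add, hx, hy]
    | tmul b b' => simp

/-- The flip of the first two of three tensor factors. -/
def flipLeft (k M : Type) [Field k] [AddCommGroup M] [Module k M] :
    (M ⊗[k] M) ⊗[k] M →ₗ[k] (M ⊗[k] M) ⊗[k] M :=
  TensorProduct.map (tau k M) (idm k M)

/-- The cyclic permutation `x ⊗ y ⊗ z ↦ y ⊗ z ⊗ x`. -/
def rotate (k M : Type) [Field k] [AddCommGroup M] [Module k M] :
    (M ⊗[k] M) ⊗[k] M →ₗ[k] (M ⊗[k] M) ⊗[k] M :=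
  (TensorProduct.comm k M (M ⊗[k] M)).toLinearMap ∘ₗ (TensorProduct.assoc k M M M).toLinearMap

@[simp] lemma flipLeft_tmul (x : M ⊗[k] M) (z : M) :
    flipLeft k M (x ⊗ₜ[k] z) = tau k M x ⊗ₜ[k] z := rfl

@[simp] lemma rotate_tmul (x y z : M) :
    rotate k M ((x ⊗ₜ[k] y) ⊗ₜ[k] z) = (y ⊗ₜ[k] z) ⊗ₜ[k] x := rfl

@[simp] lemma flipLeft_flipLeft (t : (M ⊗[k] M) ⊗[k] M) :
    flipLeft k M (flipLeft k M t) = t := by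
  induction t with
  | zero => simp
  | add x y hx hy => simp only [map_add, hx, hy]
  | tmul x y => simp

lemma rotate_rotate (t : (M ⊗[k] M) ⊗[k] M) :
    rotate k M (rotate k M t) = flipLeft k M (rotate k M (flipLeft k M t)) := by
  induction t with
  | zero => simp
  | add x y hx hy => simp only [map_add, hx, hy]
  | tmul x z =>
    induction x with
    | zero => simp
    | add u v hu hv => simp only [map_add, TensorProduct.add_tmul, hu, hv]
    | tmul u v => simp

lemma map_id_tau (δ : M →ₗ[k] M ⊗[k] M) (s : M ⊗[k] M) :
    TensorProduct.map δ (idm k M) (tau k M s)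
      = rotate k M (unassoc k M (TensorProduct.map (idm k M) δ s)) := by
  induction s with
  | zero => simp
  | add x y hx hy => simp only [map_add, hx, hy]
  | tmul x y =>
    simp only [tau_tmul, TensorProduct.map_tmul, idm_apply]
    induction δ y with
    | zero => simp
    | add u v hu hv => simp only [map_add, TensorProduct.add_tmul, TensorProduct.tmul_add, hu, hv]
    | tmul u v => simp

lemma map_tau_comp_id (δ : M →ₗ[k] M ⊗[k] M) (s : M ⊗[k] M) :
    TensorProduct.map (tau k M ∘ₗ δ) (idm k M) s
      = flipLeft k M (TensorProduct.map δ (idm k M) s) := by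
  induction s with
  | zero => simp
  | add x y hx hy => simp only [map_add, hx, hy]
  | tmul x y => simp

lemma unassoc_map_tau (δ : M →ₗ[k] M ⊗[k] M) (s : M ⊗[k] M) :
    unassoc k M (TensorProduct.map (idm k M) δ (tau k M s))
      = flipLeft k M (rotate k M (flipLeft k M (TensorProduct.map δ (idm k M) s))) := by
  induction s with
  | zero => simp
  | add x y hx hy => simp only [map_add, hx, hy]
  | tmul x y =>
    simp only [tau_tmul, TensorProduct.map_tmul, idm_apply]
    induction δ x with
    | zero => simp
    | add u v hu hv => simp only [map_add, TensorProduct.add_tmul, TensorProduct.tmul_add, hu, hv]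
    | tmul u v => simp

lemma unassoc_map_tau_comp (δ : M →ₗ[k] M ⊗[k] M) (s : M ⊗[k] M) :
    unassoc k M (TensorProduct.map (idm k M) (tau k M ∘ₗ δ) s)
      = rotate k M (flipLeft k M (unassoc k M (TensorProduct.map (idm k M) δ s))) := by
  induction s with
  | zero => simp
  | add x y hx hy => simp only [map_add, hx, hy]
  | tmul x y =>
    simp only [TensorProduct.map_tmul, idm_apply, LinearMap.comp_apply]
    induction δ y with
    | zero => simp
    | add u v hu hv => simp only [map_add, TensorProduct.tmul_add, hu, hv]
    | tmul u v => simp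

lemma unassoc_map_tau_comp_tau (δ : M →ₗ[k] M ⊗[k] M) (s : M ⊗[k] M) :
    unassoc k M (TensorProduct.map (idm k M) (tau k M ∘ₗ δ) (tau k M s))
      = flipLeft k M (rotate k M (TensorProduct.map δ (idm k M) s)) := by
  induction s with
  | zero => simp
  | add x y hx hy => simp only [map_add, hx, hy]
  | tmul x y =>
    simp only [tau_tmul, TensorProduct.map_tmul, idm_apply, LinearMap.comp_apply]
    induction δ x with
    | zero => simp
    | add u v hu hv => simp only [map_add, TensorProduct.add_tmul, TensorProduct.tmul_add, hu, hv]
    | tmul u v => simp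

/-- The interchange isomorphism for three factors. -/
def interchange₃ (k A B : Type) [Field k] [AddCommGroup A] [Module k A]
    [AddCommGroup B] [Module k B] :
    ((A ⊗[k] A) ⊗[k] A) ⊗[k] ((B ⊗[k] B) ⊗[k] B) →ₗ[k]
      ((A ⊗[k] B) ⊗[k] (A ⊗[k] B)) ⊗[k] (A ⊗[k] B) :=
  TensorProduct.map (intch k A B) LinearMap.id ∘ₗ
    (TensorProduct.tensorTensorTensorComm k (A ⊗[k] A) A (B ⊗[k] B) B).toLinearMap

@[simp] lemma interchange₃_tmul (s : A ⊗[k] A) (a : A) (t : B ⊗[k] B) (b : B) :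
    interchange₃ k A B ((s ⊗ₜ[k] a) ⊗ₜ[k] (t ⊗ₜ[k] b))
      = intch k A B (s ⊗ₜ[k] t) ⊗ₜ[k] (a ⊗ₜ[k] b) := rfl

lemma map_intch_id (δ : A →ₗ[k] A ⊗[k] A) (μ : B →ₗ[k] B ⊗[k] B)
    (s : A ⊗[k] A) (t : B ⊗[k] B) :
    TensorProduct.map (intch k A B ∘ₗ TensorProduct.map δ μ) (idm k (A ⊗[k] B))
        (intch k A B (s ⊗ₜ[k] t))
      = interchange₃ k A B
          (TensorProduct.map δ (idm k A) s ⊗ₜ[k] TensorProduct.map μ (idm k B) t) := by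
  induction s with
  | zero => simp
  | add x y hx hy => simp only [map_add, TensorProduct.add_tmul, hx, hy]
  | tmul a a' =>
    induction t with
    | zero => simp
    | add x y hx hy => simp only [map_add, TensorProduct.tmul_add, hx, hy]
    | tmul b b' => simp

lemma unassoc_map_id_intch (δ : A →ₗ[k] A ⊗[k] A) (μ : B →ₗ[k] B ⊗[k] B)
    (s : A ⊗[k] A) (t : B ⊗[k] B) :
    unassoc k (A ⊗[k] B)
        (TensorProduct.map (idm k (A ⊗[k] B)) (intch k A B ∘ₗ TensorProduct.map δ μ)
          (intch k A B (s ⊗ₜ[k] t)))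
      = interchange₃ k A B
          (unassoc k A (TensorProduct.map (idm k A) δ s) ⊗ₜ[k]
            unassoc k B (TensorProduct.map (idm k B) μ t)) := by
  induction s with
  | zero => simp
  | add x y hx hy => simp only [map_add, TensorProduct.add_tmul, hx, hy]
  | tmul a a' =>
    induction t with
    | zero => simp
    | add x y hx hy => simp only [map_add, TensorProduct.tmul_add, hx, hy]
    | tmul b b' =>
      simp only [intch_tmul, TensorProduct.map_tmul, idm_apply, LinearMap.comp_apply]
      induction δ a' with
      | zero => simp
      | add x y hx hy => simp only [map_add, TensorProduct.add_tmul, TensorProduct.tmul_add, hx, hy]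
      | tmul x x' =>
        induction μ b' with
        | zero => simp
        | add u v hu hv =>
          simp only [map_add, TensorProduct.tmul_add, hu, hv]
        | tmul y y' => simp

/-- Contraction of the last tensor factor against a functional. -/
def contractLast (V : Type) [AddCommGroup V] [Module k V] (f : B →ₗ[k] k) :
    V ⊗[k] B →ₗ[k] V :=
  (TensorProduct.rid k V).toLinearMap ∘ₗ LinearMap.lTensor V f

@[simp] lemma contractLast_tmul {V : Type} [AddCommGroup V] [Module k V] (f : B →ₗ[k] k)
    (v : V) (b : B) : contractLast V f (v ⊗ₜ[k] b) = f b • v := rfl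

lemma eq_zero_of_contractLast [FiniteDimensional k B] {V : Type} [AddCommGroup V] [Module k V]
    (t : V ⊗[k] B) (h : ∀ f : B →ₗ[k] k, contractLast V f t = 0) : t = 0 := by
  let b := Module.finBasis k B
  have key : ∀ s : V ⊗[k] B, s = ∑ i, contractLast V (b.coord i) s ⊗ₜ[k] b i := by
    intro s
    induction s with
    | zero => simp
    | add x y hx hy =>
      simp only [map_add, TensorProduct.add_tmul, Finset.sum_add_distrib]
      rw [← hx, ← hy]
    | tmul v w =>
      simp only [contractLast_tmul, TensorProduct.smul_tmul, ← TensorProduct.tmul_sum,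
        Module.Basis.coord_apply, b.sum_repr]
  rw [key t]
  simp [h]

lemma contractLast_map_id {V W : Type} [AddCommGroup V] [Module k V] [AddCommGroup W]
    [Module k W] (g : V →ₗ[k] W) (f : B →ₗ[k] k) (s : V ⊗[k] B) :
    contractLast W f (TensorProduct.map g (idm k B) s) = g (contractLast V f s) := by
  induction s with
  | zero => simp
  | add x y hx hy => simp only [map_add, hx, hy]
  | tmul x y => simp

lemma contractLast_unassoc_map (μ : B →ₗ[k] B ⊗[k] B) (f : B →ₗ[k] k) (s : B ⊗[k] B) :
    contractLast (B ⊗[k] B) f (unassoc k B (TensorProduct.map (idm k B) μ s))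
      = TensorProduct.map (idm k B) (contractLast B f ∘ₗ μ) s := by
  induction s with
  | zero => simp
  | add x y hx hy => simp only [map_add, hx, hy]
  | tmul x y =>
    simp only [TensorProduct.map_tmul, idm_apply, LinearMap.comp_apply]
    induction μ y with
    | zero => simp
    | add u v hu hv => simp only [map_add, TensorProduct.tmul_add, hu, hv]
    | tmul u v => simp

end Tensors

section QuadraticPerm

variable {k B : Type} [Field k] [AddCommGroup B] [Module k B]
  {dia : B →ₗ[k] B →ₗ[k] B} {ω : B →ₗ[k] B →ₗ[k] k}
  {ωh : B ⊗[k] B →ₗ[k] B ⊗[k] B →ₗ[k] k} {ν : B →ₗ[k] B ⊗[k] B}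

/-- Left multiplications are self-adjoint for an invariant antisymmetric form. -/
lemma form_dia_left (hω₁ : ∀ b₁ b₂ : B, ω b₁ b₂ = - ω b₂ b₁)
    (hω₃ : ∀ b₁ b₂ b₃ : B, ω (dia b₁ b₂) b₃ = ω b₁ (dia b₂ b₃ - dia b₃ b₂)) (a b c : B) :
    ω (dia a b) c = ω b (dia a c) := by
  have h₁ := hω₃ a b c
  have h₂ := hω₃ a c b
  rw [map_sub] at h₁ h₂
  rw [hω₁ b]
  linear_combination h₁ + h₂

lemma exists_form_eq [FiniteDimensional k B] (hω₁ : ∀ b₁ b₂ : B, ω b₁ b₂ = - ω b₂ b₁)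
    (hω₂ : ∀ b₁ : B, (∀ b₂ : B, ω b₁ b₂ = 0) → b₁ = 0) (f : B →ₗ[k] k) :
    ∃ z, f = ω.flip z := by
  have hinj : Function.Injective ω := by
    rw [injective_iff_map_eq_zero]
    intro b hb
    exact hω₂ b fun c => by rw [hb]; rfl
  have hsurj : Function.Surjective ω :=
    (LinearMap.injective_iff_surjective_of_finrank_eq_finrank
      (Subspace.dual_finrank_eq (K := k) (V := B)).symm).1 hinj
  obtain ⟨z, hz⟩ := hsurj f
  refine ⟨-z, ?_⟩
  ext b
  rw [← hz, hω₁, LinearMap.flip_apply, map_neg]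

lemma form_contractLast (hωh : ∀ u₁ u₂ v₁ v₂ : B,
      ωh (u₁ ⊗ₜ[k] u₂) (v₁ ⊗ₜ[k] v₂) = ω u₁ v₁ * ω u₂ v₂) (t : B ⊗[k] B) (x y : B) :
    ω (contractLast B (ω.flip y) t) x = ωh t (x ⊗ₜ[k] y) := by
  induction t with
  | zero => simp
  | add u v hu hv => simp only [map_add, LinearMap.add_apply, hu, hv]
  | tmul u v => simp [hωh, mul_comm]

lemma form_ext [FiniteDimensional k B] (hω₁ : ∀ b₁ b₂ : B, ω b₁ b₂ = - ω b₂ b₁)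
    (hω₂ : ∀ b₁ : B, (∀ b₂ : B, ω b₁ b₂ = 0) → b₁ = 0)
    (hωh : ∀ u₁ u₂ v₁ v₂ : B, ωh (u₁ ⊗ₜ[k] u₂) (v₁ ⊗ₜ[k] v₂) = ω u₁ v₁ * ω u₂ v₂)
    {s t : B ⊗[k] B} (h : ∀ x y, ωh s (x ⊗ₜ[k] y) = ωh t (x ⊗ₜ[k] y)) : s = t := by
  rw [← sub_eq_zero]
  refine eq_zero_of_contractLast _ fun f => hω₂ _ fun x => ?_
  obtain ⟨y, rfl⟩ := exists_form_eq hω₁ hω₂ f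
  rw [form_contractLast hωh, map_sub, LinearMap.sub_apply, h, sub_self]

lemma form_map (hωh : ∀ u₁ u₂ v₁ v₂ : B,
      ωh (u₁ ⊗ₜ[k] u₂) (v₁ ⊗ₜ[k] v₂) = ω u₁ v₁ * ω u₂ v₂) {f f' g g' : B →ₗ[k] B}
    (hf : ∀ u v, ω (f u) v = ω u (f' v)) (hg : ∀ u v, ω (g u) v = ω u (g' v))
    (t : B ⊗[k] B) (x y : B) :
    ωh (TensorProduct.map f g t) (x ⊗ₜ[k] y) = ωh t (f' x ⊗ₜ[k] g' y) := by
  induction t with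
  | zero => simp
  | add u v hu hv => simp only [map_add, LinearMap.add_apply, hu, hv]
  | tmul u v => simp [hωh, hf, hg]

lemma form_tau (hωh : ∀ u₁ u₂ v₁ v₂ : B,
      ωh (u₁ ⊗ₜ[k] u₂) (v₁ ⊗ₜ[k] v₂) = ω u₁ v₁ * ω u₂ v₂) (t : B ⊗[k] B) (x y : B) :
    ωh (tau k B t) (x ⊗ₜ[k] y) = ωh t (y ⊗ₜ[k] x) := by
  induction t with
  | zero => simp
  | add u v hu hv => simp only [map_add, LinearMap.add_apply, hu, hv]
  | tmul u v => simp [hωh, mul_comm]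

/-- Compatibility of the product and the dual coproduct of a quadratic perm algebra. -/
lemma quadraticPerm_compat [FiniteDimensional k B] (hdia : IsPerm dia)
    (hω₁ : ∀ b₁ b₂ : B, ω b₁ b₂ = - ω b₂ b₁)
    (hω₂ : ∀ b₁ : B, (∀ b₂ : B, ω b₁ b₂ = 0) → b₁ = 0)
    (hω₃ : ∀ b₁ b₂ b₃ : B, ω (dia b₁ b₂) b₃ = ω b₁ (dia b₂ b₃ - dia b₃ b₂))
    (hωh : ∀ u₁ u₂ v₁ v₂ : B, ωh (u₁ ⊗ₜ[k] u₂) (v₁ ⊗ₜ[k] v₂) = ω u₁ v₁ * ω u₂ v₂)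
    (hν : ∀ b₁ b₂ b₃ : B, ωh (ν b₁) (b₂ ⊗ₜ[k] b₃) = - ω b₁ (dia b₂ b₃)) (b c : B) :
    TensorProduct.map (idm k B) (dia b) (ν c) = ν (dia b c) ∧
    TensorProduct.map (idm k B) (dia.flip b) (ν c) = ν (dia c b) ∧
    TensorProduct.map (dia b) (idm k B) (ν c) = ν (dia b c) ∧
    TensorProduct.map (dia.flip b) (idm k B) (ν c) = 0 ∧
    tau k B (ν (dia b c) - ν (dia c b)) = ν (dia b c) - ν (dia c b) := by
  have hL := form_dia_left hω₁ hω₃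
  have hR : ∀ u v, ω (dia.flip b u) v = ω u ((dia b - dia.flip b) v) := fun u v => hω₃ u b v
  have hI : ∀ u v, ω (idm k B u) v = ω u (idm k B v) := fun _ _ => rfl
  have h₁ : ∀ x y z, dia x (dia y z) = dia (dia x y) z := fun x y z => (hdia x y z).1
  have h₂ : ∀ x y z, dia (dia x y) z = dia (dia y x) z := fun x y z => (hdia x y z).2
  refine ⟨?_, ?_, ?_, ?_, ?_⟩ <;> refine form_ext hω₁ hω₂ hωh fun x y => ?_
  · rw [form_map hωh hI (hL b), hν, hν, hL, idm_apply, h₁, h₁, h₂]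
  · rw [form_map hωh hI hR, hν, hν, hω₃]
    simp only [idm_apply, LinearMap.sub_apply, LinearMap.flip_apply, map_sub, h₁]
    rw [h₂ x b y]
  · rw [form_map hωh (hL b) hI, hν, hν, hL, idm_apply, h₁]
  · rw [form_map hωh hR hI, hν]
    simp only [idm_apply, LinearMap.sub_apply, LinearMap.flip_apply, map_sub, map_zero,
      LinearMap.zero_apply]
    rw [h₂ x b y, sub_self, neg_zero]
  · rw [form_tau hωh]
    simp only [map_sub, LinearMap.sub_apply, hν]
    rw [hL b c, hL b c, hω₃ c b, hω₃ c b, map_sub, map_sub, h₂ x y b]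
    ring

/-- The dual coproduct of a quadratic perm algebra is a perm coproduct. -/
lemma quadraticPerm_isPermCo [FiniteDimensional k B] (hdia : IsPerm dia)
    (hω₁ : ∀ b₁ b₂ : B, ω b₁ b₂ = - ω b₂ b₁)
    (hω₂ : ∀ b₁ : B, (∀ b₂ : B, ω b₁ b₂ = 0) → b₁ = 0)
    (hω₃ : ∀ b₁ b₂ b₃ : B, ω (dia b₁ b₂) b₃ = ω b₁ (dia b₂ b₃ - dia b₃ b₂))
    (hωh : ∀ u₁ u₂ v₁ v₂ : B, ωh (u₁ ⊗ₜ[k] u₂) (v₁ ⊗ₜ[k] v₂) = ω u₁ v₁ * ω u₂ v₂)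
    (hν : ∀ b₁ b₂ b₃ : B, ωh (ν b₁) (b₂ ⊗ₜ[k] b₃) = - ω b₁ (dia b₂ b₃)) :
    IsPermCo ν := by
  have hK : ∀ z b, contractLast B (ω.flip z) (ν b) = dia b z - dia z b := by
    intro z b
    rw [← sub_eq_zero]
    refine hω₂ _ fun w => ?_
    rw [map_sub, LinearMap.sub_apply, form_contractLast hωh, hν, map_sub, LinearMap.sub_apply,
      hω₃ b z w, form_dia_left hω₁ hω₃ z b, map_sub]
    ring
  have hC := quadraticPerm_compat hdia hω₁ hω₂ hω₃ hωh hν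
  intro b
  refine ⟨?_, ?_⟩ <;> rw [← sub_eq_zero] <;>
    refine eq_zero_of_contractLast _ fun f => ?_ <;>
    obtain ⟨z, rfl⟩ := exists_form_eq hω₁ hω₂ f <;>
    rw [map_sub, sub_eq_zero, contractLast_map_id, hK]
  · have hKν : contractLast B (ω.flip z) ∘ₗ ν + dia z = dia.flip z :=
      LinearMap.ext fun c => by simp [hK]
    rw [contractLast_unassoc_map, map_sub, ← (hC z b).1, ← (hC z b).2.1, ← hKν,
      TensorProduct.map_add_right, LinearMap.add_apply, add_sub_cancel_right]
  · rw [contractLast_map_id, contractLast_map_id, hK, map_sub, (hC b z).2.2.2.2]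

end QuadraticPerm

theorem statement6 (k A B : Type) [Field k] [CharZero k]
    [AddCommGroup A] [Module k A] [FiniteDimensional k A]
    [AddCommGroup B] [Module k B] [FiniteDimensional k B]
    (ast : A →ₗ[k] A →ₗ[k] A) (hast : IsZinbiel ast)
    (ϑ : A →ₗ[k] A ⊗[k] A) (hϑ : IsZinbielCo ϑ)
    (hZb1 : ∀ a₁ a₂ : A,
      ϑ (ast a₁ a₂) + tau k A (ϑ (ast a₁ a₂))
        = TensorProduct.map (idm k A) (ast.flip a₂) (ϑ a₁)
          + TensorProduct.map (ast a₁) (idm k A) (ϑ a₂)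
          + tau k A (TensorProduct.map (idm k A) (ast a₁) (ϑ a₂)))
    (hZb2 : ∀ a₁ a₂ : A,
      ϑ (ast a₁ a₂ + ast a₂ a₁)
        = TensorProduct.map (ast a₁) (idm k A) (ϑ a₂)
          + TensorProduct.map (idm k A) (ast a₂) (ϑ a₁)
          + TensorProduct.map (idm k A) (ast.flip a₂) (ϑ a₁))
    (dia : B →ₗ[k] B →ₗ[k] B) (hdia : IsPerm dia)
    (ω : B →ₗ[k] B →ₗ[k] k)
    (hω₁ : ∀ b₁ b₂ : B, ω b₁ b₂ = - ω b₂ b₁)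
    (hω₂ : ∀ b₁ : B, (∀ b₂ : B, ω b₁ b₂ = 0) → b₁ = 0)
    (hω₃ : ∀ b₁ b₂ b₃ : B, ω (dia b₁ b₂) b₃ = ω b₁ (dia b₂ b₃ - dia b₃ b₂))
    (ωh : B ⊗[k] B →ₗ[k] B ⊗[k] B →ₗ[k] k)
    (hωh : ∀ u₁ u₂ v₁ v₂ : B, ωh (u₁ ⊗ₜ[k] u₂) (v₁ ⊗ₜ[k] v₂) = ω u₁ v₁ * ω u₂ v₂)
    (ν : B →ₗ[k] B ⊗[k] B)
    (hν : ∀ b₁ b₂ b₃ : B, ωh (ν b₁) (b₂ ⊗ₜ[k] b₃) = - ω b₁ (dia b₂ b₃))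
    (m : A ⊗[k] B →ₗ[k] A ⊗[k] B →ₗ[k] A ⊗[k] B)
    (hm : ∀ (a₁ a₂ : A) (b₁ b₂ : B),
      m (a₁ ⊗ₜ[k] b₁) (a₂ ⊗ₜ[k] b₂)
        = (ast a₁ a₂) ⊗ₜ[k] (dia b₁ b₂) + (ast a₂ a₁) ⊗ₜ[k] (dia b₂ b₁))
    (Δ : A ⊗[k] B →ₗ[k] (A ⊗[k] B) ⊗[k] (A ⊗[k] B))
    (hΔ : ∀ (a : A) (b : B),
      Δ (a ⊗ₜ[k] b)
        = intch k A (B) ((ϑ a) ⊗ₜ[k] (ν b))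
          + tau k (A ⊗[k] B) (intch k A (B) ((ϑ a) ⊗ₜ[k] (ν b))))
    :
    (∀ u v : A ⊗[k] B, m u v = m v u) ∧
    (∀ u v w : A ⊗[k] B, m (m u v) w = m u (m v w)) ∧
    (∀ q : A ⊗[k] B, tau k (A ⊗[k] B) (Δ q) = Δ q) ∧
    (∀ q : A ⊗[k] B,
      TensorProduct.map Δ (idm k (A ⊗[k] B)) (Δ q)
        = unassoc k (A ⊗[k] B) (TensorProduct.map (idm k (A ⊗[k] B)) Δ (Δ q))) ∧
    (∀ u v : A ⊗[k] B,
      Δ (m u v) = TensorProduct.map (m v) (idm k (A ⊗[k] B)) (Δ u)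
        + TensorProduct.map (idm k (A ⊗[k] B)) (m u) (Δ v)) := by
  have hC := quadraticPerm_compat hdia hω₁ hω₂ hω₃ hωh hν
  have hνco := quadraticPerm_isPermCo hdia hω₁ hω₂ hω₃ hωh hν
  have hml : ∀ a b, m (a ⊗ₜ[k] b)
      = TensorProduct.map (ast a) (dia b) + TensorProduct.map (ast.flip a) (dia.flip b) :=
    fun a b => TensorProduct.ext' fun a' b' => hm a a' b b'
  have hΔl : Δ = intch k A B ∘ₗ TensorProduct.map ϑ ν
      + intch k A B ∘ₗ TensorProduct.map (tau k A ∘ₗ ϑ) (tau k B ∘ₗ ν) :=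
    TensorProduct.ext' fun a b => by rw [hΔ, tau_intch]; rfl
  refine ⟨?_, ?_, ?_, ?_, ?_⟩
  · intro u v
    induction u with
    | zero => simp
    | add x y hx hy => simp only [map_add, LinearMap.add_apply, hx, hy]
    | tmul a₁ b₁ =>
      induction v with
      | zero => simp
      | add x y hx hy => simp only [map_add, LinearMap.add_apply, hx, hy]
      | tmul a₂ b₂ => rw [hm, hm, add_comm]
  · intro u v w
    induction u with
    | zero => simp
    | add x y hx hy => simp only [map_add, LinearMap.add_apply, hx, hy]
    | tmul a₁ b₁ =>
      induction v with
      | zero => simp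
      | add x y hx hy => simp only [map_add, LinearMap.add_apply, hx, hy]
      | tmul a₂ b₂ =>
        induction w with
        | zero => simp
        | add x y hx hy => simp only [map_add, hx, hy]
        | tmul a₃ b₃ =>
          simp only [hm, map_add, LinearMap.add_apply, hast _ _ _, (hdia _ _ _).1,
            TensorProduct.add_tmul]
          rw [(hdia b₂ b₁ b₃).2, (hdia b₃ b₂ b₁).2, (hdia b₃ b₁ b₂).2]
          abel
  · intro q
    rw [hΔl]
    induction q with
    | zero => simp
    | add x y hx hy => simp only [map_add, hx, hy]
    | tmul a b =>
      simp only [LinearMap.add_apply, LinearMap.comp_apply, TensorProduct.map_tmul, map_add,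
        tau_intch, tau_tau]
      rw [add_comm]
  · intro q
    induction q with
    | zero => simp
    | add x y hx hy => simp only [map_add, hx, hy]
    | tmul a b =>
      have hA : TensorProduct.map ϑ (idm k A) (ϑ a)
          + flipLeft k A (TensorProduct.map ϑ (idm k A) (ϑ a))
          = unassoc k A (TensorProduct.map (idm k A) ϑ (ϑ a)) := hϑ a
      obtain ⟨hB₁, hB₂⟩ := hνco b
      change _ = flipLeft k B _ at hB₂
      rw [hΔ, tau_intch, hΔl]
      simp only [TensorProduct.map_add_left, TensorProduct.map_add_right, LinearMap.add_apply,
        map_add, map_intch_id, unassoc_map_id_intch]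
      simp only [unassoc_map_tau_comp_tau]
      simp only [map_id_tau, map_tau_comp_id, unassoc_map_tau, unassoc_map_tau_comp]
      rw [← hB₁, ← hA]
      generalize TensorProduct.map ϑ (idm k A) (ϑ a) = α at *
      generalize TensorProduct.map ν (idm k B) (ν b) = β at *
      simp only [rotate_rotate, ← hB₂, map_add, flipLeft_flipLeft, TensorProduct.add_tmul]
      abel
  · intro u v
    induction u with
    | zero => simp [TensorProduct.map_zero_right]
    | add x y hx hy =>
      simp only [map_add, LinearMap.add_apply, TensorProduct.map_add_right, hx, hy]
      abel
    | tmul a₁ b₁ =>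
      induction v with
      | zero => simp [TensorProduct.map_zero_left]
      | add x y hx hy =>
        simp only [map_add, LinearMap.add_apply, TensorProduct.map_add_left, hx, hy]
        abel
      | tmul a₂ b₂ =>
        have hid : idm k (A ⊗[k] B) = TensorProduct.map (idm k A) (idm k B) :=
          TensorProduct.map_id.symm
        obtain ⟨h₁, h₂, -, -, h₅⟩ := hC b₁ b₂
        obtain ⟨-, -, h₃, h₄, -⟩ := hC b₂ b₁
        have h₆ := (hC b₁ b₂).2.2.1
        have h₇ := (hC b₁ b₂).2.2.2.1
        have h₈ := (hC b₂ b₁).1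
        have h₉ := (hC b₂ b₁).2.1
        have hτ : tau k B (ν (dia b₂ b₁))
            = tau k B (ν (dia b₁ b₂)) - (ν (dia b₁ b₂) - ν (dia b₂ b₁)) := by
          rw [← h₅, map_sub, sub_sub_cancel]
        have hx := congrArg (fun s => intch k A B (s ⊗ₜ[k] ν (dia b₁ b₂))) (hZb2 a₂ a₁)
        have hy := congrArg (fun s => intch k A B (tau k A s ⊗ₜ[k] tau k B (ν (dia b₁ b₂))))
          (hZb2 a₁ a₂)
        have hz := congrArg
          (fun s => intch k A B (s ⊗ₜ[k] (ν (dia b₁ b₂) - ν (dia b₂ b₁)))) (hZb1 a₂ a₁)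
        rw [hm, map_add, hΔ, hΔ, hΔ, hΔ, hml, hml, hid]
        simp only [tau_intch, TensorProduct.map_add_left, TensorProduct.map_add_right,
          LinearMap.add_apply, map_add, map_map_intch]
        simp only [← tau_map, h₁, h₂, h₃, h₄, h₆, h₇, h₈, h₉, map_zero, TensorProduct.tmul_zero,
          add_zero]
        simp only [hτ, map_add, map_sub, TensorProduct.add_tmul, TensorProduct.tmul_sub]
          at hx hy hz ⊢
        linear_combination (norm := module) hx + hy - hz
end
end

section
/- Let k be a field of characteristic zero, A a k-vector space with two bilinear products ∗ and ∘ and a nondegenerate bilinear form ϖ, and let (B, ⋄, ω) be the specific perm algebra on the free k-module on (ℤ×ℤ)×{1,2} with its specific antisymmetric invariant bilinear form ω. Let · and [−,−] be the induced product and bracket on A ⊗ B, and define 𝔅(a₁ ⊗ b₁, a₂ ⊗ b₂) = ϖ(a₁, a₂)·ω(b₁, b₂). Then the following are equivalent: (i) (A ⊗ B, ·, [−,−]) is a Poisson algebra and 𝔅 is antisymmetric and satisfies both cyclic conditions 𝔅(u₁·u₂, u₃) + 𝔅(u₂·u₃, u₁) + 𝔅(u₃·u₁, u₂) = 0 and 𝔅([u₁,u₂],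 u₃) + 𝔅([u₂,u₃], u₁) + 𝔅([u₃,u₁], u₂) = 0; (ii) (A, ∗, ∘, ϖ) is a quasi-Frobenius pre-Poisson algebra. -/
open TensorProduct

noncomputable section

theorem tmul_bB_induction {k A : Type} [Field k] [AddCommGroup A] [Module k A]
    {p : A ⊗[k] PermB k → Prop} (hzero : p 0) (hadd : ∀ u v, p u → p v → p (u + v))
    (tmul : ∀ (a : A) (i₁ i₂ : ℤ) (s : Fin 2), p (a ⊗ₜ[k] bB k i₁ i₂ s)) (u : A ⊗[k] PermB k) :
    p u := by
  induction u using TensorProduct.induction_on with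
  | zero => exact hzero
  | add u v hu hv => exact hadd u v hu hv
  | tmul a b =>
    induction b using Finsupp.induction_linear with
    | zero => simpa using hzero
    | add f g hf hg => simpa [TensorProduct.tmul_add] using hadd _ _ hf hg
    | single x r =>
      obtain ⟨⟨i₁, i₂⟩, s⟩ := x
      have h := tmul (r • a) i₁ i₂ s
      rwa [TensorProduct.smul_tmul, bB, Finsupp.smul_single, smul_eq_mul, mul_one] at h

/-- A bi-additive map on `A ⊗ PermB` vanishing on the tensors `a ⊗ bB` is zero. -/
theorem biadditive_eq_zero {k A N : Type} [Field k] [AddCommGroup A] [Module k A]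
    [AddCommGroup N] (T : A ⊗[k] PermB k → A ⊗[k] PermB k → N)
    (hadd₁ : ∀ u u' v, T (u + u') v = T u v + T u' v)
    (hadd₂ : ∀ u v v', T u (v + v') = T u v + T u v')
    (tmul : ∀ (a b : A) (i₁ i₂ j₁ j₂ : ℤ) (s t : Fin 2),
      T (a ⊗ₜ[k] bB k i₁ i₂ s) (b ⊗ₜ[k] bB k j₁ j₂ t) = 0) (u v : A ⊗[k] PermB k) :
    T u v = 0 := by
  have zero₁ (v) : T 0 v = 0 := by simpa using hadd₁ 0 0 v
  have zero₂ (u) : T u 0 = 0 := by simpa using hadd₂ u 0 0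
  induction u using tmul_bB_induction with
  | hzero => exact zero₁ v
  | hadd u u' hu hu' => rw [hadd₁, hu, hu', add_zero]
  | tmul a i₁ i₂ s =>
    induction v using tmul_bB_induction with
    | hzero => exact zero₂ _
    | hadd v v' hv hv' => rw [hadd₂, hv, hv', add_zero]
    | tmul b j₁ j₂ t => exact tmul a b i₁ i₂ j₁ j₂ s t

/-- A tri-additive map on `A ⊗ PermB` vanishing on the tensors `a ⊗ bB` is zero. -/
theorem triadditive_eq_zero {k A N : Type} [Field k] [AddCommGroup A] [Module k A]
    [AddCommGroup N] (T : A ⊗[k] PermB k → A ⊗[k] PermB k → A ⊗[k] PermB k → N)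
    (hadd₁ : ∀ u u' v w, T (u + u') v w = T u v w + T u' v w)
    (hadd₂ : ∀ u v v' w, T u (v + v') w = T u v w + T u v' w)
    (hadd₃ : ∀ u v w w', T u v (w + w') = T u v w + T u v w')
    (tmul : ∀ (a b c : A) (i₁ i₂ j₁ j₂ l₁ l₂ : ℤ) (s t r : Fin 2),
      T (a ⊗ₜ[k] bB k i₁ i₂ s) (b ⊗ₜ[k] bB k j₁ j₂ t) (c ⊗ₜ[k] bB k l₁ l₂ r) = 0)
    (u v w : A ⊗[k] PermB k) : T u v w = 0 := by
  have zero₁ (v w) : T 0 v w = 0 := by simpa using hadd₁ 0 0 v w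
  induction u using tmul_bB_induction with
  | hzero => exact zero₁ v w
  | hadd u u' hu hu' => rw [hadd₁, hu, hu', add_zero]
  | tmul a i₁ i₂ s =>
    exact biadditive_eq_zero (fun v w => T (a ⊗ₜ[k] bB k i₁ i₂ s) v w)
      (fun v v' w => hadd₂ _ v v' w) (fun v w w' => hadd₃ _ v w w')
      (fun b c j₁ j₂ l₁ l₂ t r => tmul a b c i₁ i₂ j₁ j₂ l₁ l₂ s t r) v w

/-- The linear map `A ⊗ PermB → A` reading off the coefficient of a basis vector of `PermB`. -/
def tensorCoeff (k A : Type) [Field k] [AddCommGroup A] [Module k A] (x : (ℤ × ℤ) × Fin 2) :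
    A ⊗[k] PermB k →ₗ[k] A :=
  (TensorProduct.rid k A).toLinearMap ∘ₗ LinearMap.lTensor A (Finsupp.lapply x)

theorem tensorCoeff_tmul_bB {k A : Type} [Field k] [AddCommGroup A] [Module k A]
    (x : (ℤ × ℤ) × Fin 2) (a : A) (i₁ i₂ : ℤ) (s : Fin 2) :
    tensorCoeff k A x (a ⊗ₜ[k] bB k i₁ i₂ s) = if ((i₁, i₂), s) = x then a else 0 := by
  classical
  simp [tensorCoeff, bB, Finsupp.single_apply]

set_option maxHeartbeats 1000000 in
theorem statement19 (k A : Type) [Field k] [CharZero k]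
    [AddCommGroup A] [Module k A]
    (ast circ : A →ₗ[k] A →ₗ[k] A)
    (ϖ : A →ₗ[k] A →ₗ[k] k)
    (hnd : ∀ a : A, (∀ a' : A, ϖ a a' = 0) → a = 0)
    (dia : PermB k →ₗ[k] PermB k →ₗ[k] PermB k)
    (hdia : ∀ (i₁ i₂ j₁ j₂ : ℤ) (s t : Fin 2),
      dia (bB k i₁ i₂ s) (bB k j₁ j₂ t)
        = if s = 0 then bB k (i₁ + j₁ + 1) (i₂ + j₂) t
          else bB k (i₁ + j₁) (i₂ + j₂ + 1) t)
    (ω : PermB k →ₗ[k] PermB k →ₗ[k] k)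
    (hω : ∀ (i₁ i₂ j₁ j₂ : ℤ) (s t : Fin 2),
      ω (bB k i₁ i₂ s) (bB k j₁ j₂ t)
        = if s = 1 ∧ t = 0 then (if i₁ + j₁ = 0 ∧ i₂ + j₂ = 0 then (1 : k) else 0)
          else if s = 0 ∧ t = 1 then -(if i₁ + j₁ = 0 ∧ i₂ + j₂ = 0 then (1 : k) else 0)
          else 0)
    (m : A ⊗[k] PermB k →ₗ[k] A ⊗[k] PermB k →ₗ[k] A ⊗[k] PermB k)
    (hm : ∀ (a₁ a₂ : A) (b₁ b₂ : PermB k),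
      m (a₁ ⊗ₜ[k] b₁) (a₂ ⊗ₜ[k] b₂)
        = (ast a₁ a₂) ⊗ₜ[k] (dia b₁ b₂) + (ast a₂ a₁) ⊗ₜ[k] (dia b₂ b₁))
    (br : A ⊗[k] PermB k →ₗ[k] A ⊗[k] PermB k →ₗ[k] A ⊗[k] PermB k)
    (hbr : ∀ (a₁ a₂ : A) (b₁ b₂ : PermB k),
      br (a₁ ⊗ₜ[k] b₁) (a₂ ⊗ₜ[k] b₂)
        = (circ a₁ a₂) ⊗ₜ[k] (dia b₁ b₂) - (circ a₂ a₁) ⊗ₜ[k] (dia b₂ b₁))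
    (Bf : A ⊗[k] PermB k →ₗ[k] A ⊗[k] PermB k →ₗ[k] k)
    (hBf : ∀ (a₁ a₂ : A) (b₁ b₂ : PermB k),
      Bf (a₁ ⊗ₜ[k] b₁) (a₂ ⊗ₜ[k] b₂) = ϖ a₁ a₂ * ω b₁ b₂)
    :
    (IsPoisson (k := k) (P := A ⊗[k] PermB k) m br ∧
     (∀ u v : A ⊗[k] PermB k, Bf u v = - Bf v u) ∧
     (∀ u₁ u₂ u₃ : A ⊗[k] PermB k,
       Bf (m u₁ u₂) u₃ + Bf (m u₂ u₃) u₁ + Bf (m u₃ u₁) u₂ = 0) ∧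
     (∀ u₁ u₂ u₃ : A ⊗[k] PermB k,
       Bf (br u₁ u₂) u₃ + Bf (br u₂ u₃) u₁ + Bf (br u₃ u₁) u₂ = 0))
    ↔ (IsPrePoisson ast circ ∧ ((∀ a₁ a₂ : A, ϖ a₁ a₂ = ϖ a₂ a₁) ∧
       (∀ a₁ a₂ a₃ : A,
         ϖ (ast a₁ a₂ + ast a₂ a₁) a₃ = ϖ a₁ (ast a₂ a₃) + ϖ a₂ (ast a₁ a₃))) ∧
       (∀ a₁ a₂ a₃ : A,
         ϖ (circ a₁ a₂) a₃ - ϖ a₁ (circ a₂ a₃) = ϖ (circ a₂ a₁) a₃ - ϖ a₂ (circ a₁ a₃))) := by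
  have dia_left_comm (i₁ i₂ j₁ j₂ l₁ l₂ : ℤ) (s t r : Fin 2) :
      dia (bB k i₁ i₂ s) (dia (bB k j₁ j₂ t) (bB k l₁ l₂ r))
        = dia (bB k j₁ j₂ t) (dia (bB k i₁ i₂ s) (bB k l₁ l₂ r)) := by
    fin_cases s <;> fin_cases t <;> simp [hdia] <;> congr 1 <;> ring
  have dia_assoc (i₁ i₂ j₁ j₂ l₁ l₂ : ℤ) (s t r : Fin 2) :
      dia (dia (bB k i₁ i₂ s) (bB k j₁ j₂ t)) (bB k l₁ l₂ r)
        = dia (bB k i₁ i₂ s) (dia (bB k j₁ j₂ t) (bB k l₁ l₂ r)) := by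
    fin_cases s <;> fin_cases t <;> simp [hdia] <;> congr 1 <;> ring
  have ω_antisymm (i₁ i₂ j₁ j₂ : ℤ) (s t : Fin 2) :
      ω (bB k i₁ i₂ s) (bB k j₁ j₂ t) = - ω (bB k j₁ j₂ t) (bB k i₁ i₂ s) := by
    simp only [hω, add_comm j₁ i₁, add_comm j₂ i₂]
    fin_cases s <;> fin_cases t <;> simp
  have ω_dia_swap (i₁ i₂ j₁ j₂ l₁ l₂ : ℤ) (s t r : Fin 2) :
      ω (dia (bB k i₁ i₂ s) (bB k j₁ j₂ t)) (bB k l₁ l₂ r)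
        = - ω (dia (bB k i₁ i₂ s) (bB k l₁ l₂ r)) (bB k j₁ j₂ t) := by
    fin_cases s <;> fin_cases t <;> fin_cases r <;> simp [hdia, hω] <;> grind
  have ω_dia_cyclic (i₁ i₂ j₁ j₂ l₁ l₂ : ℤ) (s t r : Fin 2) :
      ω (dia (bB k i₁ i₂ s) (bB k j₁ j₂ t)) (bB k l₁ l₂ r)
        + ω (dia (bB k j₁ j₂ t) (bB k l₁ l₂ r)) (bB k i₁ i₂ s)
        + ω (dia (bB k l₁ l₂ r) (bB k i₁ i₂ s)) (bB k j₁ j₂ t) = 0 := by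
    fin_cases s <;> fin_cases t <;> fin_cases r <;> simp [hdia, hω] <;> grind
  constructor
  · rintro ⟨⟨-, hassoc, -, hjac, hleib⟩, hsymm, hmcyc, hbcyc⟩
    have hϖ (a b : A) : ϖ a b = ϖ b a := by
      simpa [hBf, hω] using hsymm (a ⊗ₜ bB k 0 0 1) (b ⊗ₜ bB k 0 0 0)
    refine ⟨⟨fun a b c => ?_, fun a b c => ?_, fun a b c => ?_, fun a b c => ?_⟩,
      ⟨hϖ, fun a b c => ?_⟩, fun a b c => ?_⟩
    · have h := congrArg (tensorCoeff k A ((2, 0), 1))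
        (hassoc (a ⊗ₜ bB k 0 0 0) (b ⊗ₜ bB k 0 0 0) (c ⊗ₜ bB k 0 0 1))
      simp [hm, hdia, tensorCoeff_tmul_bB] at h
      exact h.symm
    · have h := congrArg (tensorCoeff k A ((2, 0), 1))
        (hjac (a ⊗ₜ bB k 0 0 0) (b ⊗ₜ bB k 0 0 0) (c ⊗ₜ bB k 0 0 1))
      simp [hbr, hdia, tensorCoeff_tmul_bB] at h
      grind
    · have h := congrArg (tensorCoeff k A ((2, 0), 1))
        (hleib (a ⊗ₜ bB k 0 0 0) (b ⊗ₜ bB k 0 0 0) (c ⊗ₜ bB k 0 0 1))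
      simp [hm, hbr, hdia, tensorCoeff_tmul_bB] at h
      simp only [map_sub, LinearMap.sub_apply]
      grind
    · have h := congrArg (tensorCoeff k A ((2, 0), 1))
        (hleib (c ⊗ₜ bB k 0 0 1) (a ⊗ₜ bB k 0 0 0) (b ⊗ₜ bB k 0 0 0))
      simp [hm, hbr, hdia, tensorCoeff_tmul_bB] at h
      simp only [map_add, LinearMap.add_apply]
      grind
    · have h := hmcyc (a ⊗ₜ bB k 0 0 0) (b ⊗ₜ bB k 0 0 0) (c ⊗ₜ bB k (-1) 0 1)
      simp [hm, hdia, hBf, hω] at h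
      simp only [map_add, LinearMap.add_apply]
      grind
    · have h := hbcyc (a ⊗ₜ bB k 0 0 0) (b ⊗ₜ bB k 0 0 0) (c ⊗ₜ bB k (-1) 0 1)
      simp [hbr, hdia, hBf, hω] at h
      grind
  · rintro ⟨⟨hzin, hpre, hpp₁, hpp₂⟩, ⟨hϖ, hϖast⟩, hϖcirc⟩
    simp only [map_add, map_sub, LinearMap.add_apply, LinearMap.sub_apply] at hpp₁ hpp₂ hϖast
    have hpre' (a b c : A) :
        circ (circ a b) c = circ a (circ b c) + circ (circ b a) c - circ b (circ a c) := by
      linear_combination (norm := abel) hpre a b c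
    have hpp₁' (a b c : A) :
        circ a (ast b c) = ast (circ a b) c - ast (circ b a) c + ast b (circ a c) := by
      linear_combination (norm := abel) - hpp₁ a b c
    refine ⟨⟨fun u v => sub_eq_zero.mp ?_, fun u v w => sub_eq_zero.mp ?_,
      fun u v => add_eq_zero_iff_eq_neg.mp ?_, fun u v w => ?_, fun u v w => sub_eq_zero.mp ?_⟩,
      fun u v => add_eq_zero_iff_eq_neg.mp ?_, fun u v w => ?_, fun u v w => ?_⟩
    · refine biadditive_eq_zero (fun u v => m u v - m v u) ?_ ?_ ?_ u v
      iterate 2 intros; simp only [map_add, LinearMap.add_apply]; abel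
      intros; simp only [hm]; abel
    · refine triadditive_eq_zero (fun u v w => m (m u v) w - m u (m v w)) ?_ ?_ ?_ ?_ u v w
      iterate 3 intros; simp only [map_add, LinearMap.add_apply]; abel
      intro a b c i₁ i₂ j₁ j₂ l₁ l₂ s t r
      simp only [hm, map_add, LinearMap.add_apply, dia_assoc]
      rw [dia_left_comm j₁ j₂ i₁ i₂, dia_left_comm l₁ l₂ i₁ i₂, dia_left_comm l₁ l₂ j₁ j₂,
        hzin a b c, hzin a c b, hzin c a b, hzin c b a]
      simp only [TensorProduct.add_tmul]
      abel
    · refine biadditive_eq_zero (fun u v => br u v + br v u) ?_ ?_ ?_ u v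
      iterate 2 intros; simp only [map_add, LinearMap.add_apply]; abel
      intros; simp only [hbr]; abel
    · refine triadditive_eq_zero
        (fun u v w => br (br u v) w + br (br v w) u + br (br w u) v) ?_ ?_ ?_ ?_ u v w
      iterate 3 intros; simp only [map_add, LinearMap.add_apply]; abel
      intro a b c i₁ i₂ j₁ j₂ l₁ l₂ s t r
      simp only [hbr, map_sub, LinearMap.sub_apply, dia_assoc]
      rw [dia_left_comm j₁ j₂ i₁ i₂, dia_left_comm l₁ l₂ i₁ i₂, dia_left_comm l₁ l₂ j₁ j₂,
        hpre' a b c, hpre' b c a, hpre' c a b]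
      simp only [TensorProduct.add_tmul, TensorProduct.sub_tmul]
      abel
    · refine triadditive_eq_zero
        (fun u v w => br u (m v w) - (m (br u v) w + m v (br u w))) ?_ ?_ ?_ ?_ u v w
      iterate 3 intros; simp only [map_add, LinearMap.add_apply]; abel
      intro a b c i₁ i₂ j₁ j₂ l₁ l₂ s t r
      simp only [hm, hbr, map_add, map_sub, LinearMap.sub_apply, dia_assoc]
      rw [dia_left_comm j₁ j₂ i₁ i₂, dia_left_comm l₁ l₂ i₁ i₂, dia_left_comm l₁ l₂ j₁ j₂,
        hpp₁' a b c, hpp₁' a c b]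
      have h := congrArg
        (· ⊗ₜ[k] dia (bB k j₁ j₂ t) (dia (bB k l₁ l₂ r) (bB k i₁ i₂ s))) (hpp₂ b c a)
      simp only [TensorProduct.add_tmul, TensorProduct.sub_tmul] at h ⊢
      linear_combination (norm := abel) - h
    · refine biadditive_eq_zero (fun u v => Bf u v + Bf v u) ?_ ?_ ?_ u v
      iterate 2 intros; simp only [map_add, LinearMap.add_apply]; abel
      intro a b i₁ i₂ j₁ j₂ s t
      simp only [hBf]
      rw [hϖ a b, ω_antisymm i₁]
      ring
    · refine triadditive_eq_zero
        (fun u v w => Bf (m u v) w + Bf (m v w) u + Bf (m w u) v) ?_ ?_ ?_ ?_ u v w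
      iterate 3 intros; simp only [map_add, LinearMap.add_apply]; abel
      intro a b c i₁ i₂ j₁ j₂ l₁ l₂ s t r
      simp only [hm, hBf, map_add, LinearMap.add_apply]
      have h₁ := hϖast a b c
      have h₂ := hϖast b c a
      have h₃ := hϖast c a b
      have hc := ω_dia_cyclic i₁ i₂ j₁ j₂ l₁ l₂ s t r
      rw [ω_dia_swap j₁ j₂ i₁ i₂, ω_dia_swap l₁ l₂ j₁ j₂, ω_dia_swap i₁ i₂ l₁ l₂]
      rw [hϖ a (ast b c), hϖ b (ast a c)] at h₁
      rw [hϖ b (ast c a), hϖ c (ast b a)] at h₂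
      grind
    · refine triadditive_eq_zero
        (fun u v w => Bf (br u v) w + Bf (br v w) u + Bf (br w u) v) ?_ ?_ ?_ ?_ u v w
      iterate 3 intros; simp only [map_add, LinearMap.add_apply]; abel
      intro a b c i₁ i₂ j₁ j₂ l₁ l₂ s t r
      simp only [hbr, hBf, map_sub, LinearMap.sub_apply]
      have h₁ := hϖcirc a b c
      have h₂ := hϖcirc b c a
      have hc := ω_dia_cyclic i₁ i₂ j₁ j₂ l₁ l₂ s t r
      rw [ω_dia_swap j₁ j₂ i₁ i₂, ω_dia_swap l₁ l₂ j₁ j₂, ω_dia_swap i₁ i₂ l₁ l₂]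
      rw [hϖ a (circ b c), hϖ b (circ a c)] at h₁
      rw [hϖ b (circ c a), hϖ c (circ b a)] at h₂
      grind
end
end
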